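/- arXiv:1805.09174 — 2 statements merged into one kernel-verified Lean document; each statement's English description precedes it below -/
import Mathlib

section
/- There is a universal constant C > 0 with the following property. Fix integers d, T ≥ 1 and a real G ≥ 1 with (8G/3)·T² ≥ e^e, and let Θ₀ ⊂ B₁ be a finite set containing all signed corners {θ ∈ ℝ^d : ‖θ‖₁ = 1, ‖θ‖₀ = 1} (i.e. ±e₁,…,±e_d). Let ℓ₁,…,ℓ_T satisfy (A1) and (A2, deterministic form) with constants α > 0 and β ∈ (0,1]. Run the Squint/BOA algorithm with the elements of Θ₀ as the points θ₁,…,θ_K, the uniform initial probability vector, and parameter E = 8G/3, producing predictions θ̂₀,…,θ̂_{T−1}. Then for every θ ∈ B₁: (1/T) Σ_{t=1}^T (ℓ_t(θ̂_{t−1}) − ℓ_t(θ)) ≤ C (a/(α T))^{1/(2−β)} + C G D(θ, Θ₀) √(a/T) + C a G / T, where a := log Card(Θ₀) + log log(GT) + 1 and D(θ, Θ₀) := min_{θ' ∈ Θ₀} D(θ, θ'). -/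
open Finset

/-- ℓ¹-norm on `Fin d → ℝ`. -/
noncomputable def l1 {d : ℕ} (x : Fin d → ℝ) : ℝ := ∑ i, |x i|

/-- ℓ⁰ "norm": number of nonzero coordinates. -/
noncomputable def l0 {d : ℕ} (x : Fin d → ℝ) : ℕ :=
  (Finset.univ.filter fun i => x i ≠ 0).card

/-- Euclidean dot product. -/
noncomputable def dotp {d : ℕ} (x y : Fin d → ℝ) : ℝ := ∑ i, x i * y i

/-- Gradient of `f` at `θ` (coordinates of the Fréchet derivative). -/
noncomputable def grad {d : ℕ} (f : (Fin d → ℝ) → ℝ) (θ : Fin d → ℝ) : Fin d → ℝ :=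
  fun i => fderiv ℝ f θ (Pi.single i 1)

/-- Averaging accelerability `D(θ, θ')`. -/
noncomputable def Dacc {d : ℕ} (θ θ' : Fin d → ℝ) : ℝ :=
  sInf {p : ℝ | p ∈ Set.Icc (0 : ℝ) 1 ∧ l1 (θ - (1 - p) • θ') ≤ p}

/-- The Squint/BOA weight update: given parameter `E`, number of learning rates `M`,
initial weights `π0` and linearized regrets `r`, the weight of expert `k` after
observing rounds `1,…,t`.  The learning rates are `η i = (e^i E)⁻¹`, `i = 1,…,M`. -/
noncomputable def boaWeight {K : ℕ} (E : ℝ) (M : ℕ) (π0 : Fin K → ℝ)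
    (r : ℕ → Fin K → ℝ) (t : ℕ) (k : Fin K) : ℝ :=
  (∑ i ∈ Finset.Icc 1 M, (Real.exp i * E)⁻¹ *
      Real.exp ((Real.exp i * E)⁻¹ * ∑ s ∈ Finset.Icc 1 t,
        (r s k - (Real.exp i * E)⁻¹ * (r s k) ^ 2)) * π0 k) /
  (∑ i ∈ Finset.Icc 1 M, ∑ j, π0 j * (Real.exp i * E)⁻¹ *
      Real.exp ((Real.exp i * E)⁻¹ * ∑ s ∈ Finset.Icc 1 t,
        (r s j - (Real.exp i * E)⁻¹ * (r s j) ^ 2)))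

lemma exp_sub_sq_le_one_add {x : ℝ} (hx : |x| ≤ 1 / 3) : Real.exp (x - x ^ 2) ≤ 1 + x := by
  have hpos : 0 < 1 + x := by linarith [neg_abs_le x]
  rw [← Real.le_log_iff_exp_le hpos]
  have h := Real.abs_log_sub_add_sum_range_le (x := -x) (by rw [abs_neg]; linarith) 2
  simp only [Finset.sum_range_succ, Finset.sum_range_zero, abs_neg, sub_neg_eq_add] at h
  have h2 : |x| ^ (2 + 1) / (1 - |x|) ≤ x ^ 2 / 2 := by
    rw [div_le_iff₀ (by linarith), ← sq_abs x]
    nlinarith [sq_nonneg |x|, abs_nonneg x]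
  have h3 := (abs_le.mp (h.trans h2)).1
  norm_num at h3
  linarith

lemma l1_nonneg {d : ℕ} (x : Fin d → ℝ) : 0 ≤ l1 x := Finset.sum_nonneg fun _ _ => abs_nonneg _

lemma l1_add_le {d : ℕ} (x y : Fin d → ℝ) : l1 (x + y) ≤ l1 x + l1 y := by
  simp only [l1, ← Finset.sum_add_distrib]
  exact Finset.sum_le_sum fun i _ => abs_add_le _ _

lemma l1_smul {d : ℕ} (c : ℝ) (x : Fin d → ℝ) : l1 (c • x) = |c| * l1 x := by
  simp [l1, Finset.mul_sum, abs_mul]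

lemma l1_sub_le {d : ℕ} (x y : Fin d → ℝ) : l1 (x - y) ≤ l1 x + l1 y := by
  simpa [sub_eq_add_neg, l1] using l1_add_le x (-y)

lemma l1_sum_smul_le_one {d K : ℕ} {w : Fin K → ℝ} {θs : Fin K → Fin d → ℝ}
    (hw : ∀ k, 0 ≤ w k) (hw1 : ∑ k, w k = 1) (hθ : ∀ k, l1 (θs k) ≤ 1) :
    l1 (∑ k, w k • θs k) ≤ 1 := by
  have h : l1 (∑ k, w k • θs k) ≤ ∑ k, l1 (w k • θs k) := by
    refine Finset.le_sum_of_subadditive l1 (by simp [l1]) l1_add_le _ _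
  refine h.trans (le_of_le_of_eq (Finset.sum_le_sum fun k _ => ?_) hw1)
  rw [l1_smul, abs_of_nonneg (hw k)]
  exact mul_le_of_le_one_right (hw k) (hθ k)

lemma abs_dotp_le {d : ℕ} {g x : Fin d → ℝ} {G : ℝ} (hg : ∀ i, |g i| ≤ G) :
    |dotp g x| ≤ G * l1 x := by
  rw [dotp, l1, Finset.mul_sum]
  refine (Finset.abs_sum_le_sum_abs _ _).trans (Finset.sum_le_sum fun i _ => ?_)
  rw [abs_mul]
  exact mul_le_mul_of_nonneg_right (hg i) (abs_nonneg _)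

lemma dotp_sub {d : ℕ} (g x y : Fin d → ℝ) : dotp g (x - y) = dotp g x - dotp g y := by
  simp [dotp, mul_sub]

lemma dotp_add {d : ℕ} (g x y : Fin d → ℝ) : dotp g (x + y) = dotp g x + dotp g y := by
  simp [dotp, mul_add, Finset.sum_add_distrib]

lemma dotp_smul {d : ℕ} (c : ℝ) (g x : Fin d → ℝ) : dotp g (c • x) = c * dotp g x := by
  simp only [dotp, Finset.mul_sum, Pi.smul_apply, smul_eq_mul]
  exact Finset.sum_congr rfl fun i _ => by ring

lemma dotp_sum_smul {d K : ℕ} (g : Fin d → ℝ) (w : Fin K → ℝ) (θs : Fin K → Fin d → ℝ) :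
    dotp g (∑ k, w k • θs k) = ∑ k, w k * dotp g (θs k) := by
  simp only [dotp, Finset.sum_apply, Pi.smul_apply, smul_eq_mul, Finset.mul_sum]
  rw [Finset.sum_comm]
  exact Finset.sum_congr rfl fun k _ => Finset.sum_congr rfl fun i _ => by ring

lemma dotp_sum_left {d : ℕ} (s : Finset ℕ) (g : ℕ → Fin d → ℝ) (x : Fin d → ℝ) :
    dotp (∑ t ∈ s, g t) x = ∑ t ∈ s, dotp (g t) x := by
  simp only [dotp, Finset.sum_apply, Finset.sum_mul]
  exact Finset.sum_comm

lemma Dacc_mem {d : ℕ} {θ θ' : Fin d → ℝ} (hθ : l1 θ ≤ 1) :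
    Dacc θ θ' ∈ Set.Icc (0 : ℝ) 1 ∧ l1 (θ - (1 - Dacc θ θ') • θ') ≤ Dacc θ θ' := by
  have hclosed : IsClosed {p : ℝ | p ∈ Set.Icc (0 : ℝ) 1 ∧ l1 (θ - (1 - p) • θ') ≤ p} := by
    refine isClosed_Icc.inter (isClosed_le ?_ continuous_id)
    unfold l1
    simp only [Pi.sub_apply, Pi.smul_apply, smul_eq_mul]
    fun_prop
  exact hclosed.csInf_mem ⟨1, by simpa using hθ⟩ ⟨0, fun p hp => hp.1.1⟩

section Weights

variable {K M : ℕ} {E : ℝ} {π0 : Fin K → ℝ} (r : ℕ → Fin K → ℝ)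

/-- The normalizing constant of the Squint/BOA weights. -/
noncomputable def boaNormalizer (E : ℝ) (M : ℕ) (π0 : Fin K → ℝ) (t : ℕ) : ℝ :=
  ∑ i ∈ Finset.Icc 1 M, ∑ j, π0 j * (Real.exp i * E)⁻¹ *
    Real.exp ((Real.exp i * E)⁻¹ * ∑ s ∈ Finset.Icc 1 t,
      (r s j - (Real.exp i * E)⁻¹ * (r s j) ^ 2))

/-- The Squint/BOA potential. -/
noncomputable def boaPotential (E : ℝ) (M : ℕ) (π0 : Fin K → ℝ) (t : ℕ) : ℝ :=
  ∑ i ∈ Finset.Icc 1 M, ∑ j, π0 j *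
    Real.exp ((Real.exp i * E)⁻¹ * ∑ s ∈ Finset.Icc 1 t,
      (r s j - (Real.exp i * E)⁻¹ * (r s j) ^ 2))

lemma boaNormalizer_pos (hE : 0 < E) (hM : 1 ≤ M) (hK : 1 ≤ K) (hπ : ∀ k, 0 < π0 k) (t : ℕ) :
    0 < boaNormalizer r E M π0 t := by
  have : Nonempty (Fin K) := ⟨⟨0, hK⟩⟩
  refine Finset.sum_pos (fun i _ => Finset.sum_pos (fun j _ => ?_) Finset.univ_nonempty)
    ⟨1, by simpa using hM⟩
  have := hπ j
  positivity

lemma sum_boaWeight_mul (f : Fin K → ℝ) (t : ℕ) :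
    ∑ k, boaWeight E M π0 r t k * f k =
      (∑ i ∈ Finset.Icc 1 M, ∑ j, π0 j * (Real.exp i * E)⁻¹ *
        Real.exp ((Real.exp i * E)⁻¹ * ∑ s ∈ Finset.Icc 1 t,
          (r s j - (Real.exp i * E)⁻¹ * (r s j) ^ 2)) * f j) / boaNormalizer r E M π0 t := by
  simp only [boaWeight, div_mul_eq_mul_div, Finset.sum_mul]
  rw [← Finset.sum_div, Finset.sum_comm, boaNormalizer]
  congr 1
  exact Finset.sum_congr rfl fun i _ => Finset.sum_congr rfl fun j _ => by ring

lemma boaWeight_nonneg (hE : 0 < E) (hπ : ∀ k, 0 < π0 k) (t : ℕ) (k : Fin K) :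
    0 ≤ boaWeight E M π0 r t k := by
  unfold boaWeight
  refine div_nonneg (Finset.sum_nonneg fun i _ => ?_)
    (Finset.sum_nonneg fun i _ => Finset.sum_nonneg fun j _ => ?_)
  · have := hπ k
    positivity
  · have := hπ j
    positivity

lemma sum_boaWeight (hE : 0 < E) (hM : 1 ≤ M) (hK : 1 ≤ K) (hπ : ∀ k, 0 < π0 k) (t : ℕ) :
    ∑ k, boaWeight E M π0 r t k = 1 := by
  have h := sum_boaWeight_mul (E := E) (M := M) (π0 := π0) r (fun _ => 1) t
  simp only [mul_one] at h
  rw [h]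
  exact div_self (boaNormalizer_pos r hE hM hK hπ t).ne'

lemma boaWeight_zero (hE : 0 < E) (hM : 1 ≤ M) (hπ1 : ∑ k, π0 k = 1) (k : Fin K) :
    boaWeight E M π0 r 0 k = π0 k := by
  have hpos : 0 < ∑ i ∈ Finset.Icc 1 M, (Real.exp i * E)⁻¹ :=
    Finset.sum_pos (fun i _ => by positivity) ⟨1, by simpa using hM⟩
  simp only [boaWeight, Nat.one_pos, Finset.Icc_eq_empty_of_lt, Finset.sum_empty, mul_zero,
    Real.exp_zero, mul_one, ← Finset.sum_mul, hπ1, one_mul]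
  rw [mul_div_assoc, mul_comm, div_mul_cancel₀ _ hpos.ne']

lemma boaPotential_succ_le (hE : 0 < E) (hM : 1 ≤ M) (hK : 1 ≤ K) (hπ : ∀ k, 0 < π0 k) (t : ℕ)
    (hr : ∀ k, |r (t + 1) k| ≤ 3 / 4 * E)
    (horth : ∑ k, boaWeight E M π0 r t k * r (t + 1) k = 0) :
    boaPotential r E M π0 (t + 1) ≤ boaPotential r E M π0 t := by
  rw [sum_boaWeight_mul, div_eq_zero_iff,
    or_iff_left (boaNormalizer_pos r hE hM hK hπ t).ne'] at horth
  rw [← add_zero (boaPotential r E M π0 t), ← horth]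
  simp only [boaPotential, ← Finset.sum_add_distrib]
  refine Finset.sum_le_sum fun i hi => Finset.sum_le_sum fun j _ => ?_
  rw [Finset.sum_Icc_succ_top (by omega), mul_add, Real.exp_add]
  set η := (Real.exp i * E)⁻¹ with hη
  set w := Real.exp (η * ∑ s ∈ Finset.Icc 1 t, (r s j - η * r s j ^ 2))
  have hηpos : 0 < η := by positivity
  have hexp : (9 / 4 : ℝ) ≤ Real.exp i := by
    have h1 : (1 : ℝ) ≤ i := by exact_mod_cast (Finset.mem_Icc.mp hi).1
    linarith [Real.exp_one_gt_d9, Real.exp_le_exp.mpr h1]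
  have hsmall : |η * r (t + 1) j| ≤ 1 / 3 := by
    rw [abs_mul, abs_of_pos hηpos]
    calc η * |r (t + 1) j| ≤ η * (3 / 4 * E) := mul_le_mul_of_nonneg_left (hr j) hηpos.le
      _ = 3 / 4 * (Real.exp i)⁻¹ := by rw [hη]; field_simp
      _ ≤ 3 / 4 * (9 / 4)⁻¹ := by gcongr
      _ = 1 / 3 := by norm_num
  have h := exp_sub_sq_le_one_add hsmall
  calc π0 j * (w * Real.exp (η * (r (t + 1) j - η * r (t + 1) j ^ 2)))
      = π0 j * w * Real.exp (η * r (t + 1) j - (η * r (t + 1) j) ^ 2) := by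
        rw [← mul_assoc]; congr 2; ring
    _ ≤ π0 j * w * (1 + η * r (t + 1) j) :=
        mul_le_mul_of_nonneg_left h (mul_nonneg (hπ j).le (Real.exp_nonneg _))
    _ = _ := by ring

lemma boa_second_order_regret (hE : 0 < E) (hM : 1 ≤ M) (hK : 1 ≤ K) (hπ : ∀ k, 0 < π0 k)
    (hπ1 : ∑ k, π0 k = 1) (T : ℕ) (hr : ∀ t < T, ∀ k, |r (t + 1) k| ≤ 3 / 4 * E)
    (horth : ∀ t < T, ∑ k, boaWeight E M π0 r t k * r (t + 1) k = 0)
    {i : ℕ} (hi : i ∈ Finset.Icc 1 M) (k : Fin K) :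
    ∑ t ∈ Finset.Icc 1 T, r t k ≤
      Real.log (M / π0 k) * (Real.exp i * E) +
        (∑ t ∈ Finset.Icc 1 T, r t k ^ 2) / (Real.exp i * E) := by
  have hW : ∀ t ≤ T, boaPotential r E M π0 t ≤ M := by
    intro t
    induction t with
    | zero => intro _; simp [boaPotential, hπ1]
    | succ t ih =>
      intro ht
      exact (boaPotential_succ_le r hE hM hK hπ t (hr t ht) (horth t ht)).trans (ih (by omega))
  set x := Real.exp i * E with hx
  have hxpos : 0 < x := by positivity
  have hterm : π0 k * Real.exp (x⁻¹ * ∑ s ∈ Finset.Icc 1 T, (r s k - x⁻¹ * (r s k) ^ 2)) ≤ M := by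
    refine le_trans ?_ (hW T le_rfl)
    have h0 : ∀ (i : ℕ) (j : Fin K), 0 ≤ π0 j * Real.exp ((Real.exp i * E)⁻¹ *
        ∑ s ∈ Finset.Icc 1 T, (r s j - (Real.exp i * E)⁻¹ * (r s j) ^ 2)) :=
      fun i j => mul_nonneg (hπ j).le (Real.exp_nonneg _)
    refine le_trans ?_ (Finset.single_le_sum (fun i _ => Finset.sum_nonneg fun j _ => h0 i j) hi)
    exact Finset.single_le_sum (fun j _ => h0 i j) (Finset.mem_univ k)
  have hlog : x⁻¹ * ∑ s ∈ Finset.Icc 1 T, (r s k - x⁻¹ * (r s k) ^ 2) ≤ Real.log (M / π0 k) := by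
    have hMpos : (0 : ℝ) < M := by exact_mod_cast hM
    rw [Real.le_log_iff_exp_le (div_pos hMpos (hπ k)), le_div_iff₀ (hπ k), mul_comm]
    exact hterm
  rw [Finset.sum_sub_distrib, ← Finset.mul_sum, inv_mul_le_iff₀ hxpos] at hlog
  rw [div_eq_inv_mul _ x]
  linarith

end Weights

lemma exists_learning_rate {a V E N : ℝ} {M : ℕ} (ha : 0 < a) (hE : 0 < E) (hV : 0 ≤ V)
    (hM : 1 ≤ M) (hNM : Real.log N ≤ M) (hVN : V ≤ a * (E * N) ^ 2) (hN : 0 < N) :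
    ∃ i ∈ Finset.Icc 1 M, a * (Real.exp i * E) + V / (Real.exp i * E) ≤
      4 * Real.sqrt (a * V) + 3 * a * E := by
  have he := Real.exp_one_lt_d9
  have hsq : Real.sqrt (a * V) = Real.sqrt a * Real.sqrt V := Real.sqrt_mul ha.le V
  set p := Real.sqrt a
  set q := Real.sqrt V
  have hp2 : p ^ 2 = a := Real.sq_sqrt ha.le
  have hq2 : q ^ 2 = V := Real.sq_sqrt hV
  have hp : 0 < p := Real.sqrt_pos.mpr ha
  have hq : 0 ≤ q := Real.sqrt_nonneg V
  rw [hsq, ← hp2, ← hq2]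
  set y := q / (p * E) with hy
  have hqy : q = y * (p * E) := by rw [hy]; field_simp
  have hy0 : 0 ≤ y := by positivity
  have hz : 0 < p ^ 2 * E := by positivity
  by_cases hye : y ≤ Real.exp 1
  · refine ⟨1, by simpa using hM, ?_⟩
    rw [Nat.cast_one]
    have h1 : q ^ 2 / (Real.exp 1 * E) ≤ p * q := by
      rw [div_le_iff₀ (by positivity), hqy]
      have := mul_le_mul_of_nonneg_left hye (mul_nonneg hy0 (sq_nonneg (p * E)))
      linarith
    have h2 : p ^ 2 * (Real.exp 1 * E) ≤ 3 * p ^ 2 * E := by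
      nlinarith
    have : 0 ≤ p * q := by positivity
    linarith
  · push Not at hye
    have hypos : 0 < y := (Real.exp_pos 1).trans hye
    have hlog1 : 1 < Real.log y := (Real.lt_log_iff_exp_lt hypos).mpr hye
    set i := ⌊Real.log y⌋₊ with hi
    have hi1 : 1 ≤ i := Nat.le_floor (by simpa using hlog1.le)
    have hil : (i : ℝ) ≤ Real.log y := Nat.floor_le (by linarith)
    have hiu : Real.log y < i + 1 := Nat.lt_floor_add_one _
    have hyN : y ≤ N := by
      rw [hy, div_le_iff₀ (by positivity)]
      refine Real.sqrt_le_iff.mpr ⟨by positivity, ?_⟩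
      calc V ≤ a * (E * N) ^ 2 := hVN
        _ = _ := by rw [← hp2]; ring
    have hiM : i ≤ M := by
      have := Real.log_le_log hypos hyN
      exact_mod_cast (hil.trans this).trans hNM
    have hei : Real.exp i ≤ y := by rw [← Real.le_log_iff_exp_le hypos]; exact hil
    have hei' : y ≤ Real.exp 1 * Real.exp i := by
      rw [← Real.exp_add, ← Real.log_le_iff_le_exp hypos]; linarith
    refine ⟨i, Finset.mem_Icc.mpr ⟨hi1, hiM⟩, ?_⟩
    have h1 : p ^ 2 * (Real.exp i * E) ≤ p * q := by
      rw [hqy]; nlinarith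
    have h2 : q ^ 2 / (Real.exp i * E) ≤ 3 * (p * q) := by
      rw [div_le_iff₀ (by positivity), hqy]
      have h3 : y ≤ 3 * Real.exp i := hei'.trans (by gcongr; linarith)
      have := mul_le_mul_of_nonneg_left h3 (mul_nonneg hy0 (sq_nonneg (p * E)))
      linarith
    have : 0 ≤ p ^ 2 * E := by positivity
    linarith

lemma mul_sqrt_sub_rpow_le {c B u β : ℝ} (hc : 1 ≤ c) (hB : 0 < B) (hu : 0 ≤ u) (hβ : 0 < β)
    (hβ1 : β ≤ 1) :
    c * Real.sqrt (B * u) - u ^ (1 / β) ≤ c ^ 2 * B ^ (1 / (2 - β)) := by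
  have h2β : 0 < 2 - β := by linarith
  have hc2 : 1 ≤ c ^ 2 := one_le_pow₀ hc
  set s := u ^ (1 / β) with hs
  set b := B ^ (1 / (2 - β)) with hb
  have hs0 : 0 ≤ s := Real.rpow_nonneg hu _
  have hb0 : 0 < b := Real.rpow_pos_of_pos hB _
  have hus : u = s ^ β := by rw [hs, ← Real.rpow_mul hu, one_div_mul_cancel hβ.ne', Real.rpow_one]
  have hBb : B = b ^ (2 - β) := by
    rw [hb, ← Real.rpow_mul hB.le, one_div_mul_cancel h2β.ne', Real.rpow_one]
  by_cases h : s ≤ c ^ 2 * b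
  · have h1 : u ≤ c ^ 2 * b ^ β := by
      calc u = s ^ β := hus
        _ ≤ (c ^ 2 * b) ^ β := Real.rpow_le_rpow hs0 h hβ.le
        _ = (c ^ 2) ^ β * b ^ β := Real.mul_rpow (by positivity) hb0.le
        _ ≤ (c ^ 2) ^ (1 : ℝ) * b ^ β := by gcongr
        _ = c ^ 2 * b ^ β := by rw [Real.rpow_one]
    have h2 : Real.sqrt (B * u) ≤ c * b := by
      refine Real.sqrt_le_iff.mpr ⟨by positivity, ?_⟩
      calc B * u ≤ b ^ (2 - β) * (c ^ 2 * b ^ β) := by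
            rw [← hBb]; exact mul_le_mul_of_nonneg_left h1 hB.le
        _ = c ^ 2 * (b ^ (2 - β) * b ^ β) := by ring
        _ = (c * b) ^ 2 := by
            rw [← Real.rpow_add hb0, sub_add_cancel, mul_pow, Real.rpow_two]
    nlinarith
  · push Not at h
    have hspos : 0 < s := lt_of_le_of_lt (by positivity) h
    have h1 : c ^ 2 * B ≤ s ^ (2 - β) := by
      calc c ^ 2 * B = (c ^ 2) ^ (1 : ℝ) * b ^ (2 - β) := by rw [Real.rpow_one, ← hBb]
        _ ≤ (c ^ 2) ^ (2 - β) * b ^ (2 - β) := by gcongr; linarith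
        _ = (c ^ 2 * b) ^ (2 - β) := (Real.mul_rpow (by positivity) hb0.le).symm
        _ ≤ s ^ (2 - β) := Real.rpow_le_rpow (by positivity) h.le h2β.le
    have h2 : c * Real.sqrt (B * u) ≤ s := by
      refine abs_le_of_sq_le_sq' ?_ hs0 |>.2
      rw [mul_pow, Real.sq_sqrt (by positivity)]
      calc c ^ 2 * (B * u) = c ^ 2 * B * s ^ β := by rw [← hus]; ring
        _ ≤ s ^ (2 - β) * s ^ β := by gcongr
        _ = s ^ 2 := by rw [← Real.rpow_add hspos, sub_add_cancel, Real.rpow_two]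
    have : 0 ≤ c ^ 2 * b := by positivity
    linarith

lemma mean_rpow_le {T : ℕ} (hT : 1 ≤ T) {z : ℕ → ℝ} (hz : ∀ t, 0 ≤ z t) {p : ℝ} (hp : 1 ≤ p) :
    ((∑ t ∈ Finset.Icc 1 T, z t) / T) ^ p ≤ (∑ t ∈ Finset.Icc 1 T, z t ^ p) / T := by
  have hT0 : (0 : ℝ) < T := by exact_mod_cast hT
  have h := Real.rpow_arith_mean_le_arith_mean_rpow (Finset.Icc 1 T) (fun _ => (T : ℝ)⁻¹) z
    (fun _ _ => by positivity) (by simp [hT0.ne']) (fun t _ => hz t) hp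
  rwa [← Finset.mul_sum, ← Finset.mul_sum, ← div_eq_inv_mul, ← div_eq_inv_mul] at h

lemma sub_dotp_le_of_corners {d : ℕ} (hd : 1 ≤ d) {A B : ℝ} {g : Fin d → ℝ}
    (hcorner : ∀ c : Fin d → ℝ, l1 c = 1 → l0 c = 1 → A - dotp g c ≤ B) {x : Fin d → ℝ}
    {p : ℝ} (hx : l1 x ≤ p) :
    -dotp g x ≤ (B - A) * p := by
  have hsingle : ∀ (i : Fin d) (ε : ℝ), |ε| = 1 → A - g i * ε ≤ B := by
    intro i ε hε
    have hε0 : ε ≠ 0 := by rintro rfl; simp at hε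
    have h := hcorner (Pi.single i ε)
      (by
        rw [l1, Finset.sum_eq_single i (fun j _ hj => by simp [Pi.single_eq_of_ne hj]) (by simp)]
        simpa using hε)
      (by
        rw [l0, Finset.card_eq_one]
        refine ⟨i, Finset.ext fun j => ?_⟩
        by_cases hj : j = i
        · subst hj; simpa using hε0
        · simp [hj])
    simpa [dotp, Pi.single_apply] using h
  have hg : ∀ i, |g i| ≤ B - A := by
    intro i
    have h1 := hsingle i 1 (by simp)
    have h2 := hsingle i (-1) (by simp)
    rw [abs_le]
    constructor <;> linarith
  have hBA : 0 ≤ B - A := (abs_nonneg _).trans (hg ⟨0, hd⟩)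
  linarith [neg_abs_le (dotp g x), abs_dotp_le hg (x := x), mul_le_mul_of_nonneg_left hx hBA]

/-- Second-order regret bound against a single expert, with the learning rate tuned on the grid. -/
lemma boa_regret_le_sqrt {K T : ℕ} {G a : ℝ} (hK : 1 ≤ K) (hT : 1 ≤ T) (hG : 1 ≤ G) {M : ℕ}
    (hM : 1 ≤ M) (hlogM : Real.log ((8 * G / 3) * (T : ℝ) ^ 2) ≤ M) (ha : 4 / 5 ≤ a)
    (haKM : Real.log (K * M) ≤ 3 * a) (r : ℕ → Fin K → ℝ)
    (hr : ∀ t ∈ Finset.Icc 1 T, ∀ k, |r t k| ≤ 2 * G)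
    (horth : ∀ t < T,
      ∑ k, boaWeight (8 * G / 3) M (fun _ => 1 / (K : ℝ)) r t k * r (t + 1) k = 0) (k : Fin K) :
    ∑ t ∈ Finset.Icc 1 T, r t k ≤
      12 * Real.sqrt (a * ∑ t ∈ Finset.Icc 1 T, r t k ^ 2) + 24 * a * G := by
  have hK0 : (0 : ℝ) < K := by exact_mod_cast hK
  have hT1 : (1 : ℝ) ≤ T := by exact_mod_cast hT
  set V := ∑ t ∈ Finset.Icc 1 T, r t k ^ 2
  have hV0 : 0 ≤ V := Finset.sum_nonneg fun _ _ => sq_nonneg _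
  have hV : V ≤ T * (2 * G) ^ 2 := by
    refine (Finset.sum_le_card_nsmul _ _ ((2 * G) ^ 2) fun t ht => ?_).trans (by simp)
    exact sq_le_sq' (abs_le.mp (hr t ht k)).1 (abs_le.mp (hr t ht k)).2
  have hVN : V ≤ a * ((8 * G / 3) * (T : ℝ) ^ 2) ^ 2 := by
    have hT4 : (T : ℝ) ≤ T ^ 4 := le_self_pow₀ hT1 (by norm_num)
    calc V ≤ T * (2 * G) ^ 2 := hV
      _ ≤ T ^ 4 * (2 * G) ^ 2 := by gcongr
      _ = (9 / 16 : ℝ) * ((8 * G / 3) * (T : ℝ) ^ 2) ^ 2 := by ring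
      _ ≤ a * ((8 * G / 3) * (T : ℝ) ^ 2) ^ 2 := by gcongr; linarith
  have hN : Real.log ((T : ℝ) ^ 2) ≤ M := by
    refine (Real.log_le_log (by positivity) ?_).trans hlogM
    nlinarith [sq_nonneg (T : ℝ)]
  obtain ⟨i, hi, hbound⟩ := exists_learning_rate (E := 8 * G / 3) (N := (T : ℝ) ^ 2)
    (by linarith : 0 < a) (by positivity) hV0 hM hN hVN (by positivity)
  have h := boa_second_order_regret (E := 8 * G / 3) (π0 := fun _ => 1 / (K : ℝ)) r (by positivity)
    hM hK (fun _ => by positivity) (by simp [hK0.ne']) T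
    (fun t ht k => (hr (t + 1) (Finset.mem_Icc.mpr ⟨by omega, ht⟩) k).trans_eq (by ring)) horth hi k
  have hlog : Real.log (M / (1 / (K : ℝ))) ≤ 3 * a := by
    rwa [div_div_eq_mul_div, div_one, mul_comm]
  set x := Real.exp i * (8 * G / 3)
  have hx : 0 < x := by positivity
  have hVx : 0 ≤ V / x := by positivity
  have hlx := mul_le_mul_of_nonneg_right hlog hx.le
  linarith

/-- Accelerated linearized regret bound, from the regret bounds against the grid points. -/
lemma accelerated_regret_le {d K T : ℕ} (hd : 1 ≤ d) {G a : ℝ} (hG : 0 ≤ G)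
    (ha : 0 ≤ a) {θs : Fin K → Fin d → ℝ} (hθs : ∀ k, l1 (θs k) ≤ 1)
    (hcorner : ∀ c : Fin d → ℝ, l1 c = 1 → l0 c = 1 → ∃ k, θs k = c)
    {g z : ℕ → Fin d → ℝ} (hg : ∀ t ∈ Finset.Icc 1 T, ∀ i, |g t i| ≤ G)
    (hz : ∀ t ∈ Finset.Icc 1 T, l1 (z t) ≤ 1)
    (hregret : ∀ k, ∑ t ∈ Finset.Icc 1 T, dotp (g t) (z t - θs k) ≤
      12 * Real.sqrt (a * ∑ t ∈ Finset.Icc 1 T, dotp (g t) (z t - θs k) ^ 2) + 24 * a * G)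
    {θ : Fin d → ℝ} {p : ℝ} (hp : p ∈ Set.Icc (0 : ℝ) 1) {k : Fin K}
    (hk : l1 (θ - (1 - p) • θs k) ≤ p) :
    ∑ t ∈ Finset.Icc 1 T, dotp (g t) (z t - θ) ≤
      24 * Real.sqrt (a * ∑ t ∈ Finset.Icc 1 T, dotp (g t) (z t - θ) ^ 2) +
        60 * (p * G * Real.sqrt (a * T)) + 24 * a * G := by
  obtain ⟨hp0, hp1⟩ := hp
  set w := θ - (1 - p) • θs k with hw
  set S := Real.sqrt (a * T)
  set V := ∑ t ∈ Finset.Icc 1 T, dotp (g t) (z t - θ) ^ 2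
  have hV0 : 0 ≤ V := Finset.sum_nonneg fun _ _ => sq_nonneg _
  have hS : 0 ≤ S := Real.sqrt_nonneg _
  have hpGS : 0 ≤ p * G * S := by positivity
  have haG : 0 ≤ a * G := by positivity
  set A := ∑ t ∈ Finset.Icc 1 T, dotp (g t) (z t)
  set g' := ∑ t ∈ Finset.Icc 1 T, g t with hg'
  have hlin : ∀ x, ∑ t ∈ Finset.Icc 1 T, dotp (g t) (z t - x) = A - dotp g' x := by
    intro x
    simp only [dotp_sub, Finset.sum_sub_distrib, hg', dotp_sum_left, A]
  have hgrid : ∀ k, A - dotp g' (θs k) ≤ 24 * (G * S) + 24 * a * G := by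
    intro k
    rw [← hlin]
    refine (hregret k).trans ?_
    have hVk : ∑ t ∈ Finset.Icc 1 T, dotp (g t) (z t - θs k) ^ 2 ≤ T * (2 * G) ^ 2 := by
      refine (Finset.sum_le_card_nsmul _ _ ((2 * G) ^ 2) fun t ht => ?_).trans (by simp)
      have h1 : |dotp (g t) (z t - θs k)| ≤ 2 * G := by
        refine (abs_dotp_le (hg t ht)).trans ?_
        nlinarith [l1_sub_le (z t) (θs k), hz t ht, hθs k]
      exact sq_le_sq' (abs_le.mp h1).1 (abs_le.mp h1).2
    have hsqrt : Real.sqrt (a * ∑ t ∈ Finset.Icc 1 T, dotp (g t) (z t - θs k) ^ 2) ≤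
        2 * (G * S) := by
      calc _ ≤ Real.sqrt (a * T * (2 * G) ^ 2) := by
            apply Real.sqrt_le_sqrt
            rw [mul_assoc]
            exact mul_le_mul_of_nonneg_left hVk ha
        _ = 2 * (G * S) := by
            rw [Real.sqrt_mul (by positivity), Real.sqrt_sq (by positivity)]; ring
    linarith
  have hk' : A - dotp g' (θs k) ≤
      24 * Real.sqrt (a * V) + 36 * (p * G * S) + 24 * a * G := by
    rw [← hlin]
    refine (hregret k).trans ?_
    have hVk : ∑ t ∈ Finset.Icc 1 T, dotp (g t) (z t - θs k) ^ 2 ≤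
        2 * V + T * (8 * (p * G) ^ 2) := by
      have hsum : ∑ t ∈ Finset.Icc 1 T, (2 * dotp (g t) (z t - θ) ^ 2 + 8 * (p * G) ^ 2) =
          2 * V + T * (8 * (p * G) ^ 2) := by
        simp [Finset.sum_add_distrib, ← Finset.mul_sum, V]
      rw [← hsum]
      refine Finset.sum_le_sum fun t ht => ?_
      have hdist : l1 (θ - θs k) ≤ 2 * p := by
        have hsplit : θ - θs k = w - p • θs k := by
          rw [hw]; ext i; simp; ring
        have := l1_sub_le w (p • θs k)
        rw [← hsplit, l1_smul, abs_of_nonneg hp0] at this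
        nlinarith [hθs k]
      have h1 : |dotp (g t) (θ - θs k)| ≤ 2 * (p * G) := by
        refine (abs_dotp_le (hg t ht)).trans ?_
        nlinarith
      have h2 : dotp (g t) (θ - θs k) ^ 2 ≤ (2 * (p * G)) ^ 2 :=
        sq_le_sq' (abs_le.mp h1).1 (abs_le.mp h1).2
      have h3 : dotp (g t) (z t - θs k) = dotp (g t) (z t - θ) + dotp (g t) (θ - θs k) := by
        rw [← dotp_add, sub_add_sub_cancel]
      rw [h3]
      nlinarith [sq_nonneg (dotp (g t) (z t - θ) - dotp (g t) (θ - θs k))]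
    have hsqrt : Real.sqrt (a * ∑ t ∈ Finset.Icc 1 T, dotp (g t) (z t - θs k) ^ 2) ≤
        2 * Real.sqrt (a * V) + 3 * (p * G * S) := by
      refine Real.sqrt_le_iff.mpr ⟨by positivity, ?_⟩
      have h1 : Real.sqrt (a * V) ^ 2 = a * V := Real.sq_sqrt (by positivity)
      have h2 : S ^ 2 = a * T := Real.sq_sqrt (by positivity)
      have h3 := mul_le_mul_of_nonneg_left hVk ha
      have h4 : 0 ≤ Real.sqrt (a * V) * (p * G * S) := by positivity
      have h5 : 0 ≤ a * V := by positivity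
      have h6 : 0 ≤ (p * G) ^ 2 * (a * T) := by positivity
      calc _ ≤ a * (2 * V + T * (8 * (p * G) ^ 2)) := h3
        _ ≤ 4 * (a * V) + 9 * ((p * G) ^ 2 * (a * T)) +
            12 * (Real.sqrt (a * V) * (p * G * S)) := by linarith
        _ = _ := by linear_combination -4 * h1 - 9 * (p * G) ^ 2 * h2
    linarith
  have hcorner' := sub_dotp_le_of_corners hd (A := A) (B := 24 * (G * S) + 24 * a * G) (g := g')
    (fun c hc1 hc0 => by obtain ⟨j, rfl⟩ := hcorner c hc1 hc0; exact hgrid j) hk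
  have hθ : dotp g' θ = dotp g' w + (1 - p) * dotp g' (θs k) := by
    rw [← dotp_smul, ← dotp_add, hw, sub_add_cancel]
  rw [hlin, hθ]
  have hsq : 0 ≤ Real.sqrt (a * V) := Real.sqrt_nonneg _
  have h1 := mul_le_mul_of_nonneg_left hk' (sub_nonneg.mpr hp1)
  have h2 := mul_nonneg hp0 (by positivity : 0 ≤ 24 * Real.sqrt (a * V) + 36 * (p * G * S))
  linarith

lemma log_mul_bounds {G : ℝ} {T : ℕ} (hG : 1 ≤ G) (hT : 1 ≤ T)
    (h : Real.exp (Real.exp 1) ≤ (8 * G / 3) * (T : ℝ) ^ 2) :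
    17 / 20 ≤ Real.log (G * T) ∧
      Real.log ((8 * G / 3) * (T : ℝ) ^ 2) ≤ 1 + 2 * Real.log (G * T) := by
  have hT1 : (1 : ℝ) ≤ T := by exact_mod_cast hT
  have he := Real.exp_one_gt_d9
  have h2 : (8 * G / 3) * (T : ℝ) ^ 2 ≤ Real.exp 1 * (G * T) ^ 2 := by
    have : (8 / 3 : ℝ) * (G * T ^ 2) ≤ Real.exp 1 * (G ^ 2 * T ^ 2) := by
      gcongr
      · linarith
      · exact le_self_pow₀ hG (by norm_num)
    linarith
  have hlog := Real.log_le_log (by positivity) h2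
  rw [Real.log_mul (Real.exp_ne_zero 1) (by positivity), Real.log_exp, Real.log_pow] at hlog
  have hlog' := Real.log_le_log (by positivity) h
  rw [Real.log_exp] at hlog'
  push_cast at hlog
  exact ⟨by linarith, hlog⟩

lemma complexity_bounds {L : ℝ} {K M : ℕ} (hK : 1 ≤ K) (hM : 1 ≤ M) (hL : 17 / 20 ≤ L)
    (hML : (M : ℝ) ≤ 2 + 2 * L) :
    4 / 5 ≤ Real.log K + Real.log L + 1 ∧
      Real.log (K * M) ≤ 3 * (Real.log K + Real.log L + 1) := by
  have hK0 : (1 : ℝ) ≤ K := by exact_mod_cast hK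
  have hM0 : (1 : ℝ) ≤ M := by exact_mod_cast hM
  have hL0 : 0 < L := by linarith
  have hlogK := Real.log_nonneg hK0
  have hlogL := Real.one_sub_inv_le_log_of_pos hL0
  have hinv : L⁻¹ ≤ 20 / 17 := by
    rw [inv_le_comm₀ hL0 (by norm_num)]; linarith
  have hlogM : Real.log M ≤ 2 + Real.log L := by
    rw [Real.log_le_iff_le_exp (by linarith), Real.exp_add, Real.exp_log hL0]
    have h2 : (5 : ℝ) ≤ Real.exp 2 := by
      rw [show (2 : ℝ) = 1 + 1 by norm_num, Real.exp_add]
      nlinarith [Real.exp_one_gt_d9]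
    nlinarith
  rw [Real.log_mul (by positivity) (by positivity)]
  constructor <;> linarith

/-- Theorem 2 of the paper (deterministic form): accelerable regret bound for
Squint/BOA run on an arbitrary fixed grid `Θ₀` containing the signed corners of `B₁`,
with uniform prior and `E = 8G/3`. -/
theorem regret_bound_fixed_grid_BOA :
    ∃ C : ℝ, 0 < C ∧
      ∀ (d K T : ℕ), 1 ≤ d → 1 ≤ K → 1 ≤ T →
      ∀ (G : ℝ), 1 ≤ G → Real.exp (Real.exp 1) ≤ (8 * G / 3) * (T : ℝ) ^ 2 →
      -- the grid Θ₀ = {θs 1, …, θs K} ⊂ B₁, enumerated injectively (so Card Θ₀ = K),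
      -- containing all signed corners of B₁
      ∀ (θs : Fin K → Fin d → ℝ), Function.Injective θs → (∀ k, l1 (θs k) ≤ 1) →
      (∀ c : Fin d → ℝ, l1 c = 1 → l0 c = 1 → ∃ k, θs k = c) →
      ∀ (ℓ : ℕ → (Fin d → ℝ) → ℝ) (α β : ℝ), 0 < α → 0 < β → β ≤ 1 →
      -- (A1): convex differentiable losses with gradients bounded by `G` in sup-norm on B₁
      (∀ t, 1 ≤ t → t ≤ T → ConvexOn ℝ Set.univ (ℓ t)) →
      (∀ t, 1 ≤ t → t ≤ T → Differentiable ℝ (ℓ t)) →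
      (∀ t, 1 ≤ t → t ≤ T → ∀ θ : Fin d → ℝ, l1 θ ≤ 1 → ∀ i, |grad (ℓ t) θ i| ≤ G) →
      -- (A2, deterministic form): weak exp-concavity
      (∀ t, 1 ≤ t → t ≤ T → ∀ θ θ' : Fin d → ℝ, l1 θ ≤ 1 → l1 θ' ≤ 1 →
        ℓ t θ - ℓ t θ' ≤ dotp (grad (ℓ t) θ) (θ - θ')
          - (α * (dotp (grad (ℓ t) θ) (θ - θ')) ^ 2) ^ ((1 : ℝ) / β)) →
      -- the algorithm with uniform prior and E = 8G/3
      ∀ (θh : ℕ → Fin d → ℝ) (πh : ℕ → Fin K → ℝ) (r : ℕ → Fin K → ℝ),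
      (∀ t k, r t k = dotp (grad (ℓ t) (θh (t - 1))) (θh (t - 1) - θs k)) →
      (∀ k, πh 0 k = 1 / (K : ℝ)) →
      (∀ t, 1 ≤ t → t ≤ T → ∀ k,
        πh t k = boaWeight (8 * G / 3) ⌈Real.log ((8 * G / 3) * (T : ℝ) ^ 2)⌉₊
          (fun _ => 1 / (K : ℝ)) r t k) →
      (∀ t, t ≤ T → θh t = ∑ k, πh t k • θs k) →
      -- conclusion: for every θ in B₁, with a = log K + log log (GT) + 1
      ∀ θ : Fin d → ℝ, l1 θ ≤ 1 →
        (1 / (T : ℝ)) * ∑ t ∈ Finset.Icc 1 T, (ℓ t (θh (t - 1)) - ℓ t θ)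
          ≤ C * (((Real.log K + Real.log (Real.log (G * T)) + 1) / (α * T))
              ^ ((1 : ℝ) / (2 - β)))
            + C * G * (⨅ k, Dacc θ (θs k)) *
                Real.sqrt ((Real.log K + Real.log (Real.log (G * T)) + 1) / T)
            + C * (Real.log K + Real.log (Real.log (G * T)) + 1) * G / T := by
  refine ⟨576, by norm_num, ?_⟩
  intro d K T hd hK hT G hG hGT θs _ hθs hcorner ℓ α β hα hβ hβ1 _ _ hgrad hA2 θh πh r hr hπ0 hπ
    hθh θ hθ
  have hK0 : (0 : ℝ) < K := by exact_mod_cast hK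
  have hT0 : (0 : ℝ) < T := by exact_mod_cast hT
  have hE : (0 : ℝ) < 8 * G / 3 := by positivity
  obtain ⟨hL, hlogE⟩ := log_mul_bounds hG hT hGT
  set x := Real.log ((8 * G / 3) * (T : ℝ) ^ 2) with hx
  set M := ⌈x⌉₊
  have hxpos : 0 < x := by
    have := Real.log_le_log (Real.exp_pos _) hGT
    rw [Real.log_exp] at this
    exact (Real.exp_pos 1).trans_le this
  have hM : 1 ≤ M := Nat.ceil_pos.mpr hxpos
  have hMx : (M : ℝ) < x + 1 := Nat.ceil_lt_add_one hxpos.le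
  obtain ⟨ha, haKM⟩ := complexity_bounds hK hM hL (by linarith)
  set a := Real.log K + Real.log (Real.log (G * T)) + 1
  have ha0 : 0 < a := by linarith
  have hu0 : ∀ _ : Fin K, (0 : ℝ) < 1 / K := fun _ => by positivity
  have hu1 : ∑ _ : Fin K, 1 / (K : ℝ) = 1 := by simp [hK0.ne']
  have hweight : ∀ t ≤ T, ∀ k,
      πh t k = boaWeight (8 * G / 3) M (fun _ => 1 / (K : ℝ)) r t k := by
    intro t ht k
    rcases Nat.eq_zero_or_pos t with rfl | htpos
    · rw [hπ0, boaWeight_zero r hE hM hu1]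
    · exact hπ t htpos ht k
  have hsum : ∀ t ≤ T, ∑ k, πh t k = 1 := fun t ht => by
    simp only [hweight t ht]
    exact sum_boaWeight r hE hM hK hu0 t
  have hθh1 : ∀ t ≤ T, l1 (θh t) ≤ 1 := fun t ht => by
    rw [hθh t ht]
    refine l1_sum_smul_le_one (fun k => ?_) (hsum t ht) hθs
    rw [hweight t ht]
    exact boaWeight_nonneg r hE hu0 t k
  have hz : ∀ t ∈ Finset.Icc 1 T, l1 (θh (t - 1)) ≤ 1 := fun t ht =>
    hθh1 _ (by have := (Finset.mem_Icc.mp ht).2; omega)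
  have hg : ∀ t ∈ Finset.Icc 1 T, ∀ i, |grad (ℓ t) (θh (t - 1)) i| ≤ G := fun t ht =>
    hgrad t (Finset.mem_Icc.mp ht).1 (Finset.mem_Icc.mp ht).2 _ (hz t ht)
  have hrbound : ∀ t ∈ Finset.Icc 1 T, ∀ k, |r t k| ≤ 2 * G := by
    intro t ht k
    rw [hr]
    refine (abs_dotp_le (hg t ht)).trans ?_
    nlinarith [l1_sub_le (θh (t - 1)) (θs k), hz t ht, hθs k]
  have horth : ∀ t < T,
      ∑ k, boaWeight (8 * G / 3) M (fun _ => 1 / (K : ℝ)) r t k * r (t + 1) k = 0 := by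
    intro t ht
    simp only [← hweight t ht.le, hr, Nat.add_sub_cancel, dotp_sub, mul_sub,
      Finset.sum_sub_distrib, ← Finset.sum_mul, hsum t ht.le, one_mul, ← dotp_sum_smul,
      ← hθh t ht.le, sub_self]
  have hregret : ∀ k, ∑ t ∈ Finset.Icc 1 T, dotp (grad (ℓ t) (θh (t - 1))) (θh (t - 1) - θs k) ≤
      12 * Real.sqrt (a * ∑ t ∈ Finset.Icc 1 T,
        dotp (grad (ℓ t) (θh (t - 1))) (θh (t - 1) - θs k) ^ 2) + 24 * a * G := by
    intro k
    simpa only [hr] using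
      boa_regret_le_sqrt hK hT hG hM (Nat.le_ceil x) ha haKM r hrbound horth k
  have : Nonempty (Fin K) := ⟨⟨0, hK⟩⟩
  obtain ⟨k, hk⟩ := exists_eq_ciInf_of_finite (f := fun k => Dacc θ (θs k))
  rw [← hk]
  obtain ⟨hp, hkp⟩ := Dacc_mem (θ' := θs k) hθ
  set p := Dacc θ (θs k)
  have hacc := accelerated_regret_le hd (by linarith) ha0.le hθs hcorner
    (g := fun t => grad (ℓ t) (θh (t - 1))) (z := fun t => θh (t - 1)) hg hz hregret hp hkp
  set ρ : ℕ → ℝ := fun t => dotp (grad (ℓ t) (θh (t - 1))) (θh (t - 1) - θ)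
  change ∑ t ∈ Finset.Icc 1 T, ρ t ≤ 24 * Real.sqrt (a * ∑ t ∈ Finset.Icc 1 T, ρ t ^ 2) +
    60 * (p * G * Real.sqrt (a * T)) + 24 * a * G at hacc
  set V := ∑ t ∈ Finset.Icc 1 T, ρ t ^ 2
  have hV0 : 0 ≤ V := Finset.sum_nonneg fun _ _ => sq_nonneg _
  have hloss : ∑ t ∈ Finset.Icc 1 T, (ℓ t (θh (t - 1)) - ℓ t θ) ≤
      ∑ t ∈ Finset.Icc 1 T, ρ t - ∑ t ∈ Finset.Icc 1 T, (α * ρ t ^ 2) ^ (1 / β) := by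
    rw [← Finset.sum_sub_distrib]
    exact Finset.sum_le_sum fun t ht =>
      hA2 t (Finset.mem_Icc.mp ht).1 (Finset.mem_Icc.mp ht).2 _ _ (hz t ht) hθ
  have hjensen := mean_rpow_le hT (z := fun t => α * ρ t ^ 2) (fun t => by positivity)
    (p := 1 / β) (by rw [le_div_iff₀ hβ]; linarith)
  rw [← Finset.mul_sum] at hjensen
  have hyoung := mul_sqrt_sub_rpow_le (c := 24) (B := a / (α * T)) (u := α * V / T) (by norm_num)
    (by positivity) (by positivity) hβ hβ1
  have hdiv : ∀ y, 0 ≤ y → Real.sqrt (a * y) / T = Real.sqrt (a * y / T ^ 2) := fun y hy => by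
    rw [Real.sqrt_div (by positivity), Real.sqrt_sq hT0.le]
  have hsV : Real.sqrt (a * V) / T = Real.sqrt (a / (α * T) * (α * V / T)) := by
    rw [hdiv V hV0]; congr 1; field_simp
  have hsT : Real.sqrt (a * T) / T = Real.sqrt (a / T) := by
    rw [hdiv T hT0.le]; congr 1; field_simp
  have hpG : 0 ≤ G * p * Real.sqrt (a / T) := by have := hp.1; positivity
  have haG : 0 ≤ a * G / T := by positivity
  have hmean := div_le_div_of_nonneg_right (hloss.trans (sub_le_sub_right hacc _)) hT0.le
  rw [one_div_mul_eq_div]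
  refine hmean.trans ?_
  calc _ = 24 * (Real.sqrt (a * V) / T) + 60 * (p * G * (Real.sqrt (a * T) / T)) +
        24 * (a * G / T) - (∑ t ∈ Finset.Icc 1 T, (α * ρ t ^ 2) ^ (1 / β)) / T := by ring
    _ ≤ 576 * (a / (α * T)) ^ (1 / (2 - β)) + 576 * (G * p * Real.sqrt (a / T)) +
        576 * (a * G / T) := by rw [hsV, hsT]; linarith
    _ = _ := by ring
end

section
/- Let d₀ be a positive integer and let θ, θ*, v ∈ ℝ^d satisfy: ‖θ‖₁ ≤ 1/2, ‖θ‖₀ ≤ d₀, ‖v‖₀ ≤ d₀, ‖v‖₁ ≤ 1, and ‖θ* − v‖₂ ≤ ‖θ* − θ‖₂. Then D(θ, v) ≤ 4 √(2 d₀) ‖θ − θ*‖₂. In particular this holds when v = [θ*]_{d₀} is a hard truncation of θ* ∈ B₁ keeping its d₀ largest-magnitude coordinates. -/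
open Finset

/-- Euclidean (ℓ²) norm on `Fin d → ℝ`. -/
noncomputable def l2 {d : ℕ} (x : Fin d → ℝ) : ℝ := Real.sqrt (∑ i, (x i) ^ 2)

theorem l0_sub_le {d : ℕ} (x y : Fin d → ℝ) : l0 (x - y) ≤ l0 x + l0 y := by
  unfold l0
  refine le_trans (Finset.card_le_card ?_) (Finset.card_union_le _ _)
  intro i hi
  simp only [mem_union, mem_filter, mem_univ, true_and, Pi.sub_apply] at hi ⊢
  by_contra! h
  exact hi (by rw [h.1, h.2, sub_zero])

theorem l1_le_sqrt_l0_mul_l2 {d : ℕ} (x : Fin d → ℝ) :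
    l1 x ≤ Real.sqrt (l0 x) * l2 x := by
  have hsum : l1 x = ∑ i ∈ univ.filter (fun i => x i ≠ 0), |x i| := by
    refine (Finset.sum_subset (Finset.filter_subset _ _) fun i _ hi => ?_).symm
    simpa using hi
  rw [l2, ← Real.sqrt_mul (Nat.cast_nonneg _), hsum]
  apply Real.le_sqrt_of_sq_le
  refine sq_sum_le_card_mul_sum_sq.trans ?_
  simp only [sq_abs]
  exact mul_le_mul_of_nonneg_left
    (Finset.sum_le_univ_sum_of_nonneg fun i => sq_nonneg (x i)) (Nat.cast_nonneg _)

theorem l2_sub_comm {d : ℕ} (x y : Fin d → ℝ) : l2 (x - y) = l2 (y - x) := by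
  simp only [l2, Pi.sub_apply, sub_sq_comm]

theorem l2_sub_le_two_mul {d : ℕ} {x y z : Fin d → ℝ} (h : l2 (z - y) ≤ l2 (z - x)) :
    l2 (x - y) ≤ 2 * l2 (x - z) := by
  rw [l2_sub_comm z x] at h
  have hsq : ∑ i, (z i - y i) ^ 2 ≤ ∑ i, (x i - z i) ^ 2 :=
    (Real.sqrt_le_sqrt_iff (Finset.sum_nonneg fun i _ => sq_nonneg _)).1 h
  have hxy : ∑ i, (x i - y i) ^ 2 ≤ 2 * ∑ i, (x i - z i) ^ 2 + 2 * ∑ i, (z i - y i) ^ 2 := by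
    rw [Finset.mul_sum, Finset.mul_sum, ← Finset.sum_add_distrib]
    refine Finset.sum_le_sum fun i _ => ?_
    nlinarith [sq_nonneg ((x i - z i) - (z i - y i))]
  refine Real.sqrt_le_iff.2 ⟨mul_nonneg two_pos.le (Real.sqrt_nonneg _), ?_⟩
  rw [mul_pow, l2, Real.sq_sqrt (Finset.sum_nonneg fun i _ => sq_nonneg _)]
  simp only [Pi.sub_apply]
  linarith

theorem Dacc_le {d : ℕ} {x y : Fin d → ℝ} {p : ℝ} (hp0 : 0 ≤ p) (hp1 : p ≤ 1)
    (h : l1 (x - (1 - p) • y) ≤ p) : Dacc x y ≤ p :=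
  csInf_le ⟨0, fun _ hq => hq.1.1⟩ ⟨⟨hp0, hp1⟩, h⟩

theorem l1_sub_smul_le {d : ℕ} (x y : Fin d → ℝ) {p : ℝ} (hp0 : 0 ≤ p) (hp1 : p ≤ 1) :
    l1 (x - (1 - p) • y) ≤ p * l1 x + (1 - p) * l1 (x - y) := by
  unfold l1
  rw [Finset.mul_sum, Finset.mul_sum, ← Finset.sum_add_distrib]
  refine Finset.sum_le_sum fun i _ => ?_
  calc |(x - (1 - p) • y) i| = |p * x i + (1 - p) * (x - y) i| := by
        congr 1
        simp only [Pi.sub_apply, Pi.smul_apply, smul_eq_mul]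
        ring
    _ ≤ |p * x i| + |(1 - p) * (x - y) i| := abs_add_le _ _
    _ = p * |x i| + (1 - p) * |(x - y) i| := by
        rw [abs_mul, abs_mul, abs_of_nonneg hp0, abs_of_nonneg (sub_nonneg.2 hp1)]

theorem Dacc_le_two_mul_l1_sub {d : ℕ} {x y : Fin d → ℝ} (hx : l1 x ≤ 1 / 2) :
    Dacc x y ≤ 2 * l1 (x - y) := by
  have hs : 0 ≤ l1 (x - y) := Finset.sum_nonneg fun i _ => abs_nonneg _
  rcases le_total (2 * l1 (x - y)) 1 with h | h
  · refine Dacc_le (by positivity) h ((l1_sub_smul_le x y (by positivity) h).trans ?_)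
    nlinarith
  · refine (Dacc_le zero_le_one le_rfl ?_).trans h
    refine (l1_sub_smul_le x y zero_le_one le_rfl).trans ?_
    linarith

/-- The bound `D(θ, [θ*]_{d₀}) ≤ 4√(2d₀)‖θ - θ*‖₂` from Part 2 of the proof of
Theorem 3 of the paper, stated for any `d₀`-sparse `v` in `B₁` that approximates `θ*`
at least as well as `θ` (in particular for `v` a hard truncation of `θ*` keeping its
`d₀` largest-magnitude coordinates). -/
theorem Dacc_hardTrunc_bound {d : ℕ} (d0 : ℕ) (hd0 : 0 < d0)
    (θ θstar v : Fin d → ℝ)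
    (hθ1 : l1 θ ≤ 1 / 2) (hθ0 : l0 θ ≤ d0)
    (hv0 : l0 v ≤ d0) (hv1 : l1 v ≤ 1)
    (hclose : l2 (θstar - v) ≤ l2 (θstar - θ)) :
    Dacc θ v ≤ 4 * Real.sqrt (2 * (d0 : ℝ)) * l2 (θ - θstar) := by
  have hcard : (l0 (θ - v) : ℝ) ≤ 2 * (d0 : ℝ) := by
    have := l0_sub_le θ v
    exact_mod_cast (by omega : l0 (θ - v) ≤ 2 * d0)
  calc Dacc θ v ≤ 2 * l1 (θ - v) := Dacc_le_two_mul_l1_sub hθ1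
    _ ≤ 2 * (Real.sqrt (l0 (θ - v)) * l2 (θ - v)) := by
        gcongr
        exact l1_le_sqrt_l0_mul_l2 _
    _ ≤ 2 * (Real.sqrt (2 * (d0 : ℝ)) * (2 * l2 (θ - θstar))) := by
        have : 0 ≤ l2 (θ - v) := Real.sqrt_nonneg _
        gcongr
        exact l2_sub_le_two_mul hclose
    _ = 4 * Real.sqrt (2 * (d0 : ℝ)) * l2 (θ - θstar) := by ring
end
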